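/- Let θ be a route ending at customer i. Assume the arc costs c satisfy the triangle inequality, and assume each scenario travel time t^ω is nonnegative and satisfies the triangle inequality. Then for every extension θ' = θ ⊕ (u_1, ..., u_L) by customers u_1, ..., u_L, the reduced cost satisfies C̄_{θ'} ≥ C̄_θ + Σ_{k=1}^{L} ( π(τ_θ + min_{ω∈Ω} t^ω(i, u_k) − ℓ(u_k)) − γ(u_k) ). (Core inequality in the proof of Proposition 2: the reduced cost of an extended route is bounded below by the reduced cost of the original route minus the knapsack values of the added customers.) -/

import Mathlib

open Finset

namespace CSVRPTW

/-- The node set `V = {0, 1, …, N}`: node `0` is the depot, `1, …, N` are customers. -/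
abbrev V (N : ℕ) := Fin (N + 1)

variable {N : ℕ} {Ω : Type*} [Fintype Ω] [Nonempty Ω]

/-- Helper for the arrival-time recursion: `p` is the previous node and `ap` the arrival
time at `p`; returns the arrival time at the last node of the remaining list
(or `ap` if the list is empty). -/
def arrGo (t : V N → V N → ℝ) (e : V N → ℝ) : V N → ℝ → List (V N) → ℝ
  | _, ap, [] => ap
  | p, ap, v :: rest => arrGo t e v (max (e p) ap + t p v) rest

/-- Arrival time at the last node of a route (junk value `0` for the empty list):
`a_θ(v₁; t) = t(0, v₁)` and `a_θ(v_k; t) = max (e v_{k-1}) (a_θ(v_{k-1}; t)) + t v_{k-1} v_k`. -/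
def arrLast (t : V N → V N → ℝ) (e : V N → ℝ) : List (V N) → ℝ
  | [] => 0
  | v :: rest => arrGo t e v (t 0 v) rest

/-- Arrival time `a_θ(v_{k+1}; t)` at the node in (0-indexed) position `k` of `θ`. -/
def arr (t : V N → V N → ℝ) (e : V N → ℝ) (θ : List (V N)) (k : ℕ) : ℝ :=
  arrLast t e (θ.take (k + 1))

/-- Service start time `s_θ(v_{k+1}; t)` at the node in (0-indexed) position `k` of `θ`. -/
def srv (t : V N → V N → ℝ) (e : V N → ℝ) (θ : List (V N)) (k : ℕ) : ℝ :=
  max (e (θ.getD k 0)) (arr t e θ k)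

/-- Service start time at the last node of a route. -/
def srvLast (t : V N → V N → ℝ) (e : V N → ℝ) (θ : List (V N)) : ℝ :=
  max (e (θ.getLastD 0)) (arrLast t e θ)

/-- Earliest service start time `τ_θ = min_{ω ∈ Ω} s_θ(i; t^ω)` of a route `θ`
ending at its last customer. -/
def tau (tw : Ω → V N → V N → ℝ) (e : V N → ℝ) (θ : List (V N)) : ℝ :=
  univ.inf' univ_nonempty fun ω => srvLast (tw ω) e θ

/-- Helper: cost of the path starting at `p`, visiting the list in order,
and returning to the depot. -/
def costGo (c : V N → V N → ℝ) : V N → List (V N) → ℝ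
  | p, [] => c p 0
  | p, v :: rest => c p v + costGo c v rest

/-- Transportation cost `C_θ = c(0,v₁) + Σ_{k=2}^L c(v_{k-1},v_k) + c(v_L,0)` of a route. -/
def cost (c : V N → V N → ℝ) : List (V N) → ℝ
  | [] => 0
  | v :: rest => c 0 v + costGo c v rest

/-- Load `q_θ = Σ_{k=1}^L q(v_k)` of a route. -/
def load (q : V N → ℝ) (θ : List (V N)) : ℝ := (θ.map q).sum

/-- Total late-arrival penalty `Σ_{k=1}^L π(a_θ(v_k; t) − ℓ(v_k))` of route `θ`
under travel times `t`. -/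
def penaltySum (π : ℝ → ℝ) (ℓ : V N → ℝ) (t : V N → V N → ℝ) (e : V N → ℝ)
    (θ : List (V N)) : ℝ :=
  ∑ k : Fin θ.length, π (arr t e θ k.val - ℓ (θ.get k))

/-- Reduced cost
`C̄_θ = C_θ + Σ_ω α^ω Σ_k π(a_θ(v_k; t^ω) − ℓ(v_k)) − Σ_k γ(v_k) − μ` of a route. -/
def redCost (c : V N → V N → ℝ) (π : ℝ → ℝ) (ℓ γ : V N → ℝ) (μ : ℝ)
    (α : Ω → ℝ) (tw : Ω → V N → V N → ℝ) (e : V N → ℝ) (θ : List (V N)) : ℝ :=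
  cost c θ + (∑ ω : Ω, α ω * penaltySum π ℓ (tw ω) e θ)
    - (∑ k : Fin θ.length, γ (θ.get k)) - μ

/-- A route: a nonempty list of pairwise distinct customers. -/
def IsRoute (θ : List (V N)) : Prop := θ ≠ [] ∧ θ.Nodup ∧ ∀ v ∈ θ, v ≠ 0

/-- `d` satisfies the triangle inequality. -/
def Triangle (d : V N → V N → ℝ) : Prop := ∀ u v w, d u w ≤ d u v + d v w

theorem sum_fin_length_append {A M : Type*} [AddCommMonoid M] (f : ℕ → A → M) (l₁ l₂ : List A) :
    ∑ k : Fin (l₁ ++ l₂).length, f k.val ((l₁ ++ l₂).get k)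
      = ∑ k : Fin l₁.length, f k.val (l₁.get k)
        + ∑ k : Fin l₂.length, f (l₁.length + k.val) (l₂.get k) := by
  rw [← (finCongr (List.length_append (as := l₁) (bs := l₂)).symm).sum_comp, Fin.sum_univ_add]
  simp

theorem le_costGo {c : V N → V N → ℝ} (hc : Triangle c) (p : V N) (l : List (V N)) :
    c p 0 ≤ costGo c p l := by
  induction l generalizing p with
  | nil => exact le_rfl
  | cons v l ih => exact (hc p v 0).trans (add_le_add_right (ih v) _)

theorem costGo_le_costGo_append {c : V N → V N → ℝ} (hc : Triangle c) (p : V N)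
    (l us : List (V N)) : costGo c p l ≤ costGo c p (l ++ us) := by
  induction l generalizing p with
  | nil => exact le_costGo hc p us
  | cons v l ih => exact add_le_add_right (ih v) _

theorem cost_le_cost_append {c : V N → V N → ℝ} (hc : Triangle c) {θ : List (V N)}
    (hθ : θ ≠ []) (us : List (V N)) : cost c θ ≤ cost c (θ ++ us) := by
  cases θ with
  | nil => exact absurd rfl hθ
  | cons v l => exact add_le_add_right (costGo_le_costGo_append hc v l us) _

theorem arrGo_append (t : V N → V N → ℝ) (e : V N → ℝ) (p : V N) (a : ℝ) (l us : List (V N)) :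
    arrGo t e p a (l ++ us) = arrGo t e (l.getLastD p) (arrGo t e p a l) us := by
  induction l generalizing p a with
  | nil => rfl
  | cons v l ih =>
    rw [List.getLastD_cons]
    exact ih v _

/-- Under the triangle inequality, a detour does not make the arrival earlier than
travelling directly. -/
theorem add_le_arrGo_concat {t : V N → V N → ℝ} (ht : Triangle t) (e : V N → ℝ) (p : V N) (a : ℝ)
    (l : List (V N)) (x : V N) : max (e p) a + t p x ≤ arrGo t e p a (l ++ [x]) := by
  induction l generalizing p a with
  | nil => exact le_rfl
  | cons v l ih =>
    have h₁ : max (e v) (max (e p) a + t p v) + t v x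
        ≤ arrGo t e v (max (e p) a + t p v) (l ++ [x]) := ih v _
    have h₂ := le_max_right (e v) (max (e p) a + t p v)
    have h₃ := ht p v x
    change _ ≤ arrGo t e v (max (e p) a + t p v) (l ++ [x])
    linarith

theorem srvLast_add_le_arrLast {t : V N → V N → ℝ} (ht : Triangle t) (e : V N → ℝ)
    {θ : List (V N)} (hθ : θ ≠ []) (l : List (V N)) (x : V N) :
    srvLast t e θ + t (θ.getLastD 0) x ≤ arrLast t e (θ ++ (l ++ [x])) := by
  cases θ with
  | nil => exact absurd rfl hθ
  | cons v θ =>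
    rw [srvLast, List.getLastD_cons, List.cons_append, arrLast, arrLast, arrGo_append]
    exact add_le_arrGo_concat ht e _ _ l x

theorem arr_append_left (t : V N → V N → ℝ) (e : V N → ℝ) (θ us : List (V N)) {k : ℕ}
    (hk : k < θ.length) : arr t e (θ ++ us) k = arr t e θ k := by
  rw [arr, arr, List.take_append_of_le_length hk]

theorem srvLast_add_le_arr_append {t : V N → V N → ℝ} (ht : Triangle t) (e : V N → ℝ)
    {θ : List (V N)} (hθ : θ ≠ []) (us : List (V N)) (k : Fin us.length) :
    srvLast t e θ + t (θ.getLastD 0) (us.get k) ≤ arr t e (θ ++ us) (θ.length + k.val) := by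
  rw [arr, add_assoc, List.take_length_add_append, List.take_succ_eq_append_getElem k.isLt]
  exact srvLast_add_le_arrLast ht e hθ _ _

theorem penaltySum_append (π : ℝ → ℝ) (ℓ : V N → ℝ) (t : V N → V N → ℝ) (e : V N → ℝ)
    (θ us : List (V N)) :
    penaltySum π ℓ t e (θ ++ us) = penaltySum π ℓ t e θ
      + ∑ k : Fin us.length, π (arr t e (θ ++ us) (θ.length + k.val) - ℓ (us.get k)) := by
  rw [penaltySum, sum_fin_length_append fun k v => π (arr t e (θ ++ us) k - ℓ v), penaltySum]
  congr 1
  exact Finset.sum_congr rfl fun k _ => by rw [arr_append_left t e θ us k.isLt]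

theorem penaltySum_add_le_penaltySum_append {π : ℝ → ℝ} (hπ : Monotone π) (ℓ : V N → ℝ)
    {tw : Ω → V N → V N → ℝ} (htw : ∀ ω, Triangle (tw ω)) (e : V N → ℝ)
    {θ : List (V N)} (hθ : θ ≠ []) (us : List (V N)) (ω : Ω) :
    penaltySum π ℓ (tw ω) e θ
      + ∑ k : Fin us.length,
          π (tau tw e θ + (univ.inf' univ_nonempty fun ω => tw ω (θ.getLastD 0) (us.get k))
            - ℓ (us.get k))
      ≤ penaltySum π ℓ (tw ω) e (θ ++ us) := by
  rw [penaltySum_append]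
  refine add_le_add_right (Finset.sum_le_sum fun k _ => hπ (sub_le_sub_right ?_ _)) _
  exact (add_le_add (Finset.inf'_le _ (Finset.mem_univ ω))
    (Finset.inf'_le _ (Finset.mem_univ ω))).trans (srvLast_add_le_arr_append (htw ω) e hθ us k)

/-- **Core inequality in the proof of Proposition 2**: under the triangle inequality for
arc costs and for each nonnegative scenario travel time, the reduced cost of an extended
route `θ' = θ ⊕ (u₁, …, u_L)` is bounded below by
`C̄_θ + Σ_{k=1}^L (π(τ_θ + min_ω t^ω(i,u_k) − ℓ(u_k)) − γ(u_k))`. -/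
theorem prop2_core_inequality
    {N : ℕ} {Ω : Type*} [Fintype Ω] [Nonempty Ω]
    (c : V N → V N → ℝ) (π : ℝ → ℝ) (e ℓ γ : V N → ℝ) (μ : ℝ)
    (α : Ω → ℝ) (tw : Ω → V N → V N → ℝ)
    (hc : Triangle c)
    (hπmono : Monotone π) (hπzero : ∀ u : ℝ, u ≤ 0 → π u = 0)
    (hα : ∀ ω : Ω, 0 ≤ α ω) (hαsum : ∑ ω : Ω, α ω = 1)
    (htw : ∀ (ω : Ω) (u v : V N), 0 ≤ tw ω u v)
    (htwtri : ∀ ω : Ω, Triangle (tw ω))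
    (θ : List (V N)) (i : V N)
    (hθ : IsRoute θ) (hi : i ≠ 0) (hlast : θ.getLastD 0 = i)
    (us : List (V N)) (hus : us ≠ []) (huscust : ∀ u ∈ us, u ≠ 0) :
    redCost c π ℓ γ μ α tw e θ
      + ∑ k : Fin us.length,
          (π (tau tw e θ + (univ.inf' univ_nonempty fun ω => tw ω i (us.get k))
              - ℓ (us.get k))
            - γ (us.get k))
      ≤ redCost c π ℓ γ μ α tw e (θ ++ us) := by
  subst hlast
  have hcost := cost_le_cost_append hc hθ.1 us
  have hpen := Finset.sum_le_sum fun ω (_ : ω ∈ univ) => mul_le_mul_of_nonneg_left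
    (penaltySum_add_le_penaltySum_append hπmono ℓ htwtri e hθ.1 us ω) (hα ω)
  simp only [mul_add, Finset.sum_add_distrib, ← Finset.sum_mul, hαsum, one_mul] at hpen
  have hγ := sum_fin_length_append (fun _ v => γ v) θ us
  rw [redCost, redCost, Finset.sum_sub_distrib]
  linarith

end CSVRPTW
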